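/- arXiv:1904.10689 — 5 statements merged into one kernel-verified Lean document; each statement's English description precedes it below -/
import Mathlib

section
/- Let W_1,…,W_L be the weight matrices of an L-layer linear neural network evolving under gradient flow, i.e. for each l, τ · dW_l/dt (t) = −(W_L(t) ⋯ W_{l+1}(t))ᵀ · E(t) · (W_{l−1}(t) ⋯ W_1(t))ᵀ. Then for every l ∈ {1,…,L−1} and every time t, d/dt (W_{l+1}(t)ᵀ W_{l+1}(t)) = d/dt (W_l(t) W_l(t)ᵀ). -/
open Matrix

/-- Entrywise product rule for matrix-valued functions of a real variable. -/
theorem hasDerivAt_matrix_mul_apply {m k p : Type*} [Fintype k]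
    {M : ℝ → Matrix m k ℝ} {N : ℝ → Matrix k p ℝ} {M' : Matrix m k ℝ} {N' : Matrix k p ℝ} {t : ℝ}
    (hM : ∀ i j, HasDerivAt (fun s => M s i j) (M' i j) t)
    (hN : ∀ i j, HasDerivAt (fun s => N s i j) (N' i j) t) (i : m) (j : p) :
    HasDerivAt (fun s => (M s * N s) i j) ((M' * N t + M t * N') i j) t := by
  simp only [Matrix.add_apply, Matrix.mul_apply, ← Finset.sum_add_distrib]
  exact HasDerivAt.fun_sum fun a _ => (hM i a).mul (hN a j)

/-- For an `L`-layer linear neural network evolving under gradient flow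
`τ • dW_l/dt = -(W_L ⋯ W_{l+1})ᵀ * E(t) * (W_{l-1} ⋯ W_1)ᵀ`
(layers indexed `0, …, L-1` here; `A l t = W_{l-1} ⋯ W_0` is the prefix product and
`B l t = W_{L-1} ⋯ W_l` is the suffix product, empty products being identity matrices),
for every adjacent pair of layers `l, l+1` and every time `t`,
`d/dt (W_{l+1}ᵀ W_{l+1}) = d/dt (W_l W_lᵀ)` (entrywise). -/
theorem stmt_0
    (L : ℕ) (hL : 1 ≤ L) (n : ℕ → ℕ) (τ : ℝ) (hτ : 0 < τ)
    (W W' : (l : ℕ) → ℝ → Matrix (Fin (n (l + 1))) (Fin (n l)) ℝ)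
    (E : ℝ → Matrix (Fin (n L)) (Fin (n 0)) ℝ)
    (A : (l : ℕ) → ℝ → Matrix (Fin (n l)) (Fin (n 0)) ℝ)
    (B : (l : ℕ) → ℝ → Matrix (Fin (n L)) (Fin (n l)) ℝ)
    (hA0 : ∀ t, A 0 t = 1)
    (hA : ∀ l, l < L → ∀ t, A (l + 1) t = W l t * A l t)
    (hBL : ∀ t, B L t = 1)
    (hB : ∀ l, l < L → ∀ t, B l t = B (l + 1) t * W l t)
    (hderiv : ∀ l t i j, HasDerivAt (fun s => W l s i j) (W' l t i j) t)
    (hflow : ∀ l, l < L → ∀ t, τ • W' l t = -((B (l + 1) t)ᵀ * E t * (A l t)ᵀ))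
    (l : ℕ) (hl : l + 1 < L) (t : ℝ) (i j : Fin (n (l + 1))) :
    deriv (fun s => ((W (l + 1) s)ᵀ * W (l + 1) s) i j) t
      = deriv (fun s => (W l s * (W l s)ᵀ) i j) t := by
  have balance : (W (l + 1) t)ᵀ * W' (l + 1) t = W' l t * (W l t)ᵀ := by
    apply smul_right_injective _ hτ.ne'
    change τ • _ = τ • _
    rw [← Matrix.mul_smul, ← Matrix.smul_mul, hflow (l + 1) hl, hflow l (by omega),
      hB (l + 1) hl, hA l (by omega)]
    simp only [Matrix.transpose_mul, Matrix.mul_neg, Matrix.neg_mul, Matrix.mul_assoc]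
  have balance_transpose : (W' (l + 1) t)ᵀ * W (l + 1) t = W l t * (W' l t)ᵀ := by
    simpa using congrArg Matrix.transpose balance
  rw [(hasDerivAt_matrix_mul_apply (M := fun s => (W (l + 1) s)ᵀ) (M' := (W' (l + 1) t)ᵀ)
      (fun a b => hderiv (l + 1) t b a) (hderiv (l + 1) t) i j).deriv,
    (hasDerivAt_matrix_mul_apply (N := fun s => (W l s)ᵀ) (N' := (W' l t)ᵀ)
      (hderiv l t) (fun a b => hderiv l t b a) i j).deriv,
    balance, balance_transpose, add_comm]
end

section
/- Let W_1,…,W_L be the weight matrices of an L-layer linear neural network evolving under gradient flow, i.e. for each l, τ · dW_l/dt (t) = −(W_L(t) ⋯ W_{l+1}(t))ᵀ · E(t) · (W_{l−1}(t) ⋯ W_1(t))ᵀ. Then for every l ∈ {1,…,L−1} and every time t, (dW_l/dt)(t) · W_l(t)ᵀ = W_{l+1}(t)ᵀ · (dW_{l+1}/dt)(t). -/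
open Matrix

/-- **Statement 0.**
For an `L`-layer linear neural network evolving under gradient flow
`τ • dW_l/dt = -(W_L ⋯ W_{l+1})ᵀ * E(t) * (W_{l-1} ⋯ W_1)ᵀ`
(layers indexed `0, …, L-1` here; `A l t = W_{l-1} ⋯ W_0` is the prefix product and
`B l t = W_{L-1} ⋯ W_l` is the suffix product, empty products being identity matrices),
for every adjacent pair of layers `l, l+1` and every time `t`,
`(dW_l/dt) W_lᵀ = W_{l+1}ᵀ (dW_{l+1}/dt)`. -/
theorem stmt_1
    (L : ℕ) (hL : 1 ≤ L) (n : ℕ → ℕ) (τ : ℝ) (hτ : 0 < τ)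
    (W W' : (l : ℕ) → ℝ → Matrix (Fin (n (l + 1))) (Fin (n l)) ℝ)
    (E : ℝ → Matrix (Fin (n L)) (Fin (n 0)) ℝ)
    (A : (l : ℕ) → ℝ → Matrix (Fin (n l)) (Fin (n 0)) ℝ)
    (B : (l : ℕ) → ℝ → Matrix (Fin (n L)) (Fin (n l)) ℝ)
    (hA0 : ∀ t, A 0 t = 1)
    (hA : ∀ l, l < L → ∀ t, A (l + 1) t = W l t * A l t)
    (hBL : ∀ t, B L t = 1)
    (hB : ∀ l, l < L → ∀ t, B l t = B (l + 1) t * W l t)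
    (hderiv : ∀ l t i j, HasDerivAt (fun s => W l s i j) (W' l t i j) t)
    (hflow : ∀ l, l < L → ∀ t, τ • W' l t = -((B (l + 1) t)ᵀ * E t * (A l t)ᵀ))
    (l : ℕ) (hl : l + 1 < L) (t : ℝ) :
    W' l t * (W l t)ᵀ = (W (l + 1) t)ᵀ * W' (l + 1) t := by
  have hτW : τ • (W' l t * (W l t)ᵀ) = τ • ((W (l + 1) t)ᵀ * W' (l + 1) t) := by
    rw [← Matrix.smul_mul, ← Matrix.mul_smul, hflow l (by omega) t, hflow (l + 1) hl t,
      hA l (by omega) t, hB (l + 1) hl t]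
    simp only [Matrix.transpose_mul, Matrix.neg_mul, Matrix.mul_neg, Matrix.mul_assoc]
  exact smul_right_injective _ hτ.ne' hτW
end

section
/- Fix L ≥ 2, τ > 0 and s ∈ ℝ, and let σ_1,…,σ_L : ℝ → ℝ be differentiable functions satisfying the decoupled single-mode gradient-flow equations τ · σ̇_l(t) = (∏_{i≠l} σ_i(t)) · (s − ∏_{i=1}^L σ_i(t)) for all l ∈ {1,…,L} and all t. Then for any two layers l, l′ ∈ {1,…,L}, the quantity σ_l(t)² − σ_{l′}(t)² is constant in time. -/
/-- Fix `L ≥ 2`, `τ > 0` and `s : ℝ`, and let `σ_1, …, σ_L : ℝ → ℝ` be differentiable functions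
satisfying the decoupled single-mode gradient-flow equations
`τ σ̇_l(t) = (∏_{i ≠ l} σ_i(t)) (s - ∏_i σ_i(t))` for all `l` and `t`.  Then for any two
layers `l, l'`, the quantity `σ_l(t)² - σ_{l'}(t)²` is constant in time. -/
theorem stmt_12
    (L : ℕ) (hL : 2 ≤ L) (τ s : ℝ) (hτ : 0 < τ)
    (σ σ' : Fin L → ℝ → ℝ)
    (hderiv : ∀ l t, HasDerivAt (σ l) (σ' l t) t)
    (hflow : ∀ l t, τ * σ' l t
      = (∏ i ∈ Finset.univ.erase l, σ i t) * (s - ∏ i, σ i t))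
    (l l' : Fin L) (t t' : ℝ) :
    σ l t ^ 2 - σ l' t ^ 2 = σ l t' ^ 2 - σ l' t' ^ 2 := by
  have key (k : Fin L) (x : ℝ) :
      σ k x * σ' k x = τ⁻¹ * ((∏ i, σ i x) * (s - ∏ i, σ i x)) := by
    have hprod := Finset.mul_prod_erase Finset.univ (fun i => σ i x) (Finset.mem_univ k)
    rw [eq_inv_mul_iff_mul_eq₀ hτ.ne']
    linear_combination σ k x * hflow k x + (s - ∏ i, σ i x) * hprod
  have hd (x : ℝ) : HasDerivAt (fun y => σ l y ^ 2 - σ l' y ^ 2) 0 x := by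
    refine (((hderiv l x).pow 2).sub ((hderiv l' x).pow 2)).congr_deriv ?_
    push_cast
    linear_combination 2 * key l x - 2 * key l' x
  exact is_const_of_deriv_eq_zero (fun x => (hd x).differentiableAt) (fun x => (hd x).deriv) t t'
end

section
/- Fix L ≥ 2, τ > 0 and s ∈ ℝ, and let σ_1,…,σ_L : ℝ → ℝ be differentiable functions satisfying τ · σ̇_l(t) = (∏_{i≠l} σ_i(t)) · (s − ∏_{i=1}^L σ_i(t)) for all l and t. Let l, l′ ∈ {1,…,L} be two layers and t a time at which σ_i(t) > 0 for all i ∈ {1,…,L}, s − ∏_{i=1}^L σ_i(t) > 0, and σ_{l′}(t) > σ_l(t). Then the ratio σ_{l′}/σ_l has strictly negative derivative at t, i.e. d/dt (σ_{l′}(t)/σ_l(t)) < 0; in other words the layer singular values for the same mode move towards each other during growth. -/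
/-- Fix `L ≥ 2`, `τ > 0` and `s : ℝ`, and let `σ_1, …, σ_L : ℝ → ℝ` be differentiable functions
satisfying `τ σ̇_l(t) = (∏_{i ≠ l} σ_i(t)) (s - ∏_i σ_i(t))` for all `l` and `t`.  Let
`l, l'` be two layers and `t` a time at which all `σ_i(t) > 0`, `s - ∏_i σ_i(t) > 0` and
`σ_{l'}(t) > σ_l(t)`.  Then `d/dt (σ_{l'}(t) / σ_l(t)) < 0`: the layer singular values for
the same mode move towards each other during growth. -/
theorem stmt_13
    (L : ℕ) (hL : 2 ≤ L) (τ s : ℝ) (hτ : 0 < τ)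
    (σ σ' : Fin L → ℝ → ℝ)
    (hderiv : ∀ l t, HasDerivAt (σ l) (σ' l t) t)
    (hflow : ∀ l t, τ * σ' l t
      = (∏ i ∈ Finset.univ.erase l, σ i t) * (s - ∏ i, σ i t))
    (l l' : Fin L) (t : ℝ)
    (hpos : ∀ i, 0 < σ i t)
    (hgrow : 0 < s - ∏ i, σ i t)
    (hord : σ l t < σ l' t) :
    deriv (fun u => σ l' u / σ l u) t < 0 := by
  have energy : ∀ k, τ * σ' k t * σ k t = (∏ i, σ i t) * (s - ∏ i, σ i t) := fun k => by
    rw [hflow k t, mul_right_comm, Finset.prod_erase_mul _ _ (Finset.mem_univ k)]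
  have hl := hpos l
  have hl' := hpos l'
  have hPG : 0 < (∏ i, σ i t) * (s - ∏ i, σ i t) :=
    mul_pos (Finset.prod_pos fun i _ => hpos i) hgrow
  rw [((hderiv l' t).fun_div (hderiv l t) hl.ne').deriv]
  refine div_neg_of_neg_of_pos ?_ (by positivity)
  have hscale : 0 < τ * (σ l t * σ l' t) := by positivity
  have hscaled : τ * (σ l t * σ l' t) * (σ' l' t * σ l t - σ l' t * σ' l t)
      = (∏ i, σ i t) * (s - ∏ i, σ i t) * (σ l t ^ 2 - σ l' t ^ 2) := by
    linear_combination σ l t ^ 2 * energy l' - σ l' t ^ 2 * energy l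
  have hsq : σ l t ^ 2 - σ l' t ^ 2 < 0 := by nlinarith
  exact neg_of_mul_neg_right (hscaled ▸ mul_neg_of_pos_of_neg hPG hsq) hscale.le
end

section
/- Fix constants τ > 0, L > 0 and M > 0, and let U : [0, T] → ℝ be a differentiable function satisfying τ · U′(t) ≤ L · U(t)² · (M − U(t)) for all t ∈ [0, T], with 0 < U(0) = U₀ < M and U₀ ≤ U(t) < M for all t ∈ [0, T]. Then for any t_U ∈ [0, T] with U₁ := U(t_U) > U₀, the time obeys the lower bound t_U ≥ (τ/L) · [ (1/M²) · log( U₁ (M − U₀) / (U₀ (M − U₁)) ) − 1/(M · U₁) + 1/(M · U₀) ]. -/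
/-- An antiderivative of `1 / (u ^ 2 * (M - u))`, composed with a differentiable function. -/
lemma hasDerivAt_log_sub_log_sub_inv {M u' t : ℝ} {U : ℝ → ℝ} (hM : M ≠ 0)
    (hU : HasDerivAt U u' t) (h0 : U t ≠ 0) (h1 : M - U t ≠ 0) :
    HasDerivAt (fun s => 1 / M ^ 2 * (Real.log (U s) - Real.log (M - U s)) - 1 / M * (U s)⁻¹)
      (u' / (U t ^ 2 * (M - U t))) t := by
  have h := (((hU.log h0).sub ((hU.const_sub M).log h1)).const_mul (1 / M ^ 2)).sub
    ((hU.inv h0).const_mul (1 / M))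
  refine h.congr_deriv ?_
  field_simp
  ring


/-- Fix constants `τ > 0`, `L > 0`, `M > 0` and let `U : ℝ → ℝ` be differentiable on `[0, T]`
with `τ U'(t) ≤ L U(t)² (M - U(t))` there, `0 < U(0) = U₀ < M` and `U₀ ≤ U(t) < M` on
`[0, T]`.  Then for any `t_U ∈ [0, T]` with `U₁ := U(t_U) > U₀`,
`t_U ≥ (τ/L) [ (1/M²) log( U₁ (M - U₀) / (U₀ (M - U₁)) ) - 1/(M U₁) + 1/(M U₀) ]`. -/
theorem stmt_16
    (τ L M T : ℝ) (hτ : 0 < τ) (hLpos : 0 < L) (hM : 0 < M)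
    (U : ℝ → ℝ)
    (hdiff : ∀ t ∈ Set.Icc (0 : ℝ) T, DifferentiableAt ℝ U t)
    (hineq : ∀ t ∈ Set.Icc (0 : ℝ) T, τ * deriv U t ≤ L * U t ^ 2 * (M - U t))
    (U₀ : ℝ) (hU0 : U 0 = U₀) (hU0pos : 0 < U₀) (hU0M : U₀ < M)
    (hrange : ∀ t ∈ Set.Icc (0 : ℝ) T, U₀ ≤ U t ∧ U t < M)
    (tU : ℝ) (htU : tU ∈ Set.Icc (0 : ℝ) T)
    (U₁ : ℝ) (hU1 : U tU = U₁) (hgt : U₀ < U₁) :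
    tU ≥ (τ / L) * ((1 / M ^ 2) * Real.log (U₁ * (M - U₀) / (U₀ * (M - U₁)))
      - 1 / (M * U₁) + 1 / (M * U₀)) := by
  have hderiv : ∀ t ∈ Set.Icc (0 : ℝ) T, HasDerivAt
      (fun s => 1 / M ^ 2 * (Real.log (U s) - Real.log (M - U s)) - 1 / M * (U s)⁻¹)
      (deriv U t / (U t ^ 2 * (M - U t))) t := fun t ht =>
    hasDerivAt_log_sub_log_sub_inv hM.ne' (hdiff t ht).hasDerivAt
      (hU0pos.trans_le (hrange t ht).1).ne' (sub_pos.2 (hrange t ht).2).ne'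
  have hbound : ∀ t ∈ Set.Icc (0 : ℝ) T, deriv U t / (U t ^ 2 * (M - U t)) ≤ L / τ := by
    intro t ht
    have hpos : 0 < U t := hU0pos.trans_le (hrange t ht).1
    have hsub : 0 < M - U t := sub_pos.2 (hrange t ht).2
    rw [div_le_div_iff₀ (by positivity) hτ]
    linarith [hineq t ht]
  have hmvt := (convex_Icc (0 : ℝ) T).image_sub_le_mul_sub_of_deriv_le
    (fun t ht => (hderiv t ht).continuousAt.continuousWithinAt)
    (fun t ht => (hderiv t (interior_subset ht)).differentiableAt.differentiableWithinAt)
    (fun t ht => (hderiv t (interior_subset ht)).deriv.trans_le (hbound t (interior_subset ht)))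
    0 ⟨le_rfl, htU.1.trans htU.2⟩ tU htU htU.1
  have hU1pos : 0 < U₁ := hU0pos.trans hgt
  have hsub0 : 0 < M - U₀ := sub_pos.2 hU0M
  have hsub1 : 0 < M - U₁ := sub_pos.2 (hU1 ▸ (hrange tU htU).2)
  simp only [hU0, hU1, sub_zero] at hmvt
  rw [Real.log_div (by positivity) (by positivity), Real.log_mul hU1pos.ne' hsub0.ne',
    Real.log_mul hU0pos.ne' hsub1.ne']
  calc _ = τ / L * (1 / M ^ 2 * (Real.log U₁ - Real.log (M - U₁)) - 1 / M * U₁⁻¹ -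
        (1 / M ^ 2 * (Real.log U₀ - Real.log (M - U₀)) - 1 / M * U₀⁻¹)) := by
        field_simp
        ring
    _ ≤ τ / L * (L / τ * tU) := by gcongr
    _ = tU := by field_simp
end
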